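/- The block sums of the rule 150 total activity satisfy a Fibonacci-type linear recurrence: S(0) = 1, S(1) = 4, and for every n ≥ 2, S(n) = 2·S(n−1) + 4·S(n−2). -/

import Mathlib

/-- Rule 150 elementary cellular automaton, started from a single seed at the origin. -/
def rule150 : ℕ → ℤ → ZMod 2
  | 0, n => if n = 0 then 1 else 0
  | t + 1, n => rule150 t (n - 1) + rule150 t n + rule150 t (n + 1)

/-- Total activity: the number of active sites at time `t`. -/
noncomputable def totalActivity (t : ℕ) : ℕ := {n : ℤ | rule150 t n = 1}.ncard

/-- Block sum of the total activity over the first `2 ^ n` time steps. -/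
noncomputable def blockSum (n : ℕ) : ℕ := ∑ i ∈ Finset.range (2 ^ n), totalActivity i

theorem ncard_eq_add_ncard_even_odd {s : Set ℤ} (hs : s.Finite) :
    s.ncard = {m : ℤ | 2 * m ∈ s}.ncard + {m : ℤ | 2 * m + 1 ∈ s}.ncard := by
  have he : Function.Injective (fun m : ℤ => 2 * m) := fun a b h => by
    dsimp only at h; omega
  have ho : Function.Injective (fun m : ℤ => 2 * m + 1) := fun a b h => by
    dsimp only at h; omega
  have hunion : s = (fun m : ℤ => 2 * m) '' {m | 2 * m ∈ s} ∪
      (fun m : ℤ => 2 * m + 1) '' {m | 2 * m + 1 ∈ s} := by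
    ext n
    constructor
    · intro hn
      rcases Int.even_or_odd' n with ⟨k, rfl | rfl⟩
      · exact Or.inl ⟨k, hn, rfl⟩
      · exact Or.inr ⟨k, hn, rfl⟩
    · rintro (⟨k, hk, rfl⟩ | ⟨k, hk, rfl⟩) <;> exact hk
  have hdisj : Disjoint ((fun m : ℤ => 2 * m) '' {m | 2 * m ∈ s})
      ((fun m : ℤ => 2 * m + 1) '' {m | 2 * m + 1 ∈ s}) := by
    rw [Set.disjoint_left]
    rintro _ ⟨a, -, rfl⟩ ⟨b, -, h⟩
    dsimp only at h
    omega
  conv_lhs => rw [hunion]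
  rw [Set.ncard_union_eq hdisj ((hs.preimage he.injOn).image _) ((hs.preimage ho.injOn).image _),
    Set.ncard_image_of_injective _ he, Set.ncard_image_of_injective _ ho]

theorem ncard_setOf_add_one (p : ℤ → Prop) : {m : ℤ | p (m + 1)}.ncard = {m : ℤ | p m}.ncard := by
  rw [← Set.ncard_image_of_injective _ (add_left_injective (1 : ℤ))]
  congr 1
  ext n
  exact ⟨fun ⟨m, hm, h⟩ => h ▸ hm, fun hn => ⟨n - 1, by simpa using hn, by simp⟩⟩

theorem rule150_eq_zero_of_lt_abs (t : ℕ) (n : ℤ) (h : (t : ℤ) < |n|) : rule150 t n = 0 := by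
  induction t generalizing n with
  | zero =>
    have : n ≠ 0 := by rintro rfl; simp at h
    simp [rule150, this]
  | succ t ih =>
    push_cast at h
    have := lt_abs.mp h
    rw [rule150, ih _ (lt_abs.mpr (by omega)), ih _ (lt_abs.mpr (by omega)),
      ih _ (lt_abs.mpr (by omega))]
    simp

theorem finite_support_rule150 (t : ℕ) : (Function.support (rule150 t)).Finite := by
  refine (Set.finite_Icc (-(t : ℤ)) t).subset fun n hn => ?_
  by_contra hmem
  exact hn (rule150_eq_zero_of_lt_abs t n (not_le.mp fun h => hmem (abs_le.mp h)))

theorem finite_setOf_rule150_eq_one (t : ℕ) : {n : ℤ | rule150 t n = 1}.Finite :=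
  (finite_support_rule150 t).subset fun n hn => by
    rw [Function.mem_support, show rule150 t n = 1 from hn]
    exact one_ne_zero

/-- The number of pairs of neighbouring sites with different states at time `t`. -/
noncomputable def boundaryCount (t : ℕ) : ℕ :=
  {n : ℤ | rule150 t n + rule150 t (n + 1) = 1}.ncard

theorem finite_setOf_rule150_add_eq_one (t : ℕ) :
    {n : ℤ | rule150 t n + rule150 t (n + 1) = 1}.Finite := by
  refine ((finite_support_rule150 t).union ((finite_support_rule150 t).preimage
    (add_left_injective (1 : ℤ)).injOn)).subset fun n hn => ?_
  by_contra hmem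
  simp only [Set.mem_union, Set.mem_preimage, Function.mem_support, not_or, not_not] at hmem
  rw [Set.mem_ofPred_eq, hmem.1, hmem.2] at hn
  simp at hn

theorem rule150_add_two (t : ℕ) (n : ℤ) :
    rule150 (t + 2) n = rule150 t (n - 2) + rule150 t n + rule150 t (n + 2) := by
  simp only [rule150]
  rw [show n - 1 - 1 = n - 2 by ring, show n - 1 + 1 = n by ring, show n + 1 - 1 = n by ring,
    show n + 1 + 1 = n + 2 by ring]
  linear_combination (rule150 t (n - 1) + rule150 t n + rule150 t (n + 1)) *
    CharTwo.two_eq_zero (R := ZMod 2)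

theorem rule150_two_mul (t : ℕ) (m : ℤ) :
    rule150 (2 * t) (2 * m) = rule150 t m ∧ rule150 (2 * t) (2 * m + 1) = 0 := by
  induction t generalizing m with
  | zero =>
    have : 2 * m + 1 ≠ 0 := by omega
    simp [rule150, this]
  | succ t ih =>
    rw [Nat.mul_succ, rule150_add_two, rule150_add_two, rule150,
      show 2 * m - 2 = 2 * (m - 1) by ring, show 2 * m + 2 = 2 * (m + 1) by ring,
      show 2 * m + 1 - 2 = 2 * (m - 1) + 1 by ring, show 2 * m + 1 + 2 = 2 * (m + 1) + 1 by ring]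
    simp [ih]

theorem rule150_two_mul_add_one_even (t : ℕ) (m : ℤ) :
    rule150 (2 * t + 1) (2 * m) = rule150 t m := by
  rw [rule150, show 2 * m - 1 = 2 * (m - 1) + 1 by ring]
  simp [rule150_two_mul]

theorem rule150_two_mul_add_one_odd (t : ℕ) (m : ℤ) :
    rule150 (2 * t + 1) (2 * m + 1) = rule150 t m + rule150 t (m + 1) := by
  rw [rule150, show 2 * m + 1 - 1 = 2 * m by ring, show 2 * m + 1 + 1 = 2 * (m + 1) by ring]
  simp [rule150_two_mul]

theorem totalActivity_two_mul (t : ℕ) : totalActivity (2 * t) = totalActivity t := by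
  rw [totalActivity, ncard_eq_add_ncard_even_odd (finite_setOf_rule150_eq_one _)]
  simp [rule150_two_mul, totalActivity]

theorem totalActivity_two_mul_add_one (t : ℕ) :
    totalActivity (2 * t + 1) = totalActivity t + boundaryCount t := by
  rw [totalActivity, ncard_eq_add_ncard_even_odd (finite_setOf_rule150_eq_one _)]
  simp only [Set.mem_ofPred_eq, rule150_two_mul_add_one_even, rule150_two_mul_add_one_odd,
    totalActivity, boundaryCount]

theorem boundaryCount_two_mul (t : ℕ) : boundaryCount (2 * t) = 2 * totalActivity t := by
  rw [boundaryCount, ncard_eq_add_ncard_even_odd (finite_setOf_rule150_add_eq_one _)]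
  have h (m : ℤ) : 2 * m + 1 + 1 = 2 * (m + 1) := by ring
  simp only [Set.mem_ofPred_eq, h, (rule150_two_mul _ _).1, (rule150_two_mul _ _).2, add_zero,
    zero_add]
  rw [ncard_setOf_add_one (fun m => rule150 t m = 1), totalActivity, two_mul]

theorem boundaryCount_two_mul_add_one (t : ℕ) :
    boundaryCount (2 * t + 1) = 2 * totalActivity t := by
  rw [boundaryCount, ncard_eq_add_ncard_even_odd (finite_setOf_rule150_add_eq_one _)]
  have h (m : ℤ) : 2 * m + 1 + 1 = 2 * (m + 1) := by ring
  simp only [Set.mem_ofPred_eq, h, rule150_two_mul_add_one_even, rule150_two_mul_add_one_odd,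
    CharTwo.add_cancel_left, CharTwo.add_cancel_right]
  rw [ncard_setOf_add_one (fun m => rule150 t m = 1), totalActivity, two_mul]

theorem sum_range_two_mul (f : ℕ → ℕ) (n : ℕ) :
    ∑ i ∈ Finset.range (2 * n), f i = ∑ i ∈ Finset.range n, (f (2 * i) + f (2 * i + 1)) := by
  induction n with
  | zero => simp
  | succ n ih => rw [Nat.mul_succ, Finset.sum_range_succ, Finset.sum_range_succ, ih,
      Finset.sum_range_succ, add_assoc]

theorem blockSum_succ (n : ℕ) :
    blockSum (n + 1) = 2 * blockSum n + ∑ i ∈ Finset.range (2 ^ n), boundaryCount i := by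
  rw [blockSum, blockSum, pow_succ', sum_range_two_mul, Finset.mul_sum, ← Finset.sum_add_distrib]
  refine Finset.sum_congr rfl fun i _ => ?_
  rw [totalActivity_two_mul, totalActivity_two_mul_add_one]
  ring

theorem sum_boundaryCount_succ (n : ℕ) :
    ∑ i ∈ Finset.range (2 ^ (n + 1)), boundaryCount i = 4 * blockSum n := by
  rw [blockSum, pow_succ', sum_range_two_mul, Finset.mul_sum]
  refine Finset.sum_congr rfl fun i _ => ?_
  rw [boundaryCount_two_mul, boundaryCount_two_mul_add_one]
  ring

theorem totalActivity_zero : totalActivity 0 = 1 := by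
  simp [totalActivity, rule150]

theorem blockSum_zero : blockSum 0 = 1 := by
  simp [blockSum, totalActivity_zero]

theorem boundaryCount_zero : boundaryCount 0 = 2 := by
  simpa [totalActivity_zero] using boundaryCount_two_mul 0

theorem blockSum_recurrence :
    blockSum 0 = 1 ∧ blockSum 1 = 4 ∧
      ∀ n : ℕ, 2 ≤ n → blockSum n = 2 * blockSum (n - 1) + 4 * blockSum (n - 2) := by
  refine ⟨blockSum_zero, ?_, fun n hn => ?_⟩
  · rw [blockSum_succ, blockSum_zero]
    simp [boundaryCount_zero]
  · obtain ⟨k, rfl⟩ := Nat.exists_eq_add_of_le' hn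
    rw [blockSum_succ (k + 1), sum_boundaryCount_succ]
    rfl
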